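/- Let Γ be a β-regular distribution on [0,1] with constants (c0, C0, ε0), let μ ∼ Γ, and set U = 1−μ. Fix δ ∈ (0, ε0/8]. Then there is a constant C < ∞, depending only on (β, c0, C0, ε0), such that E[ 1{U ≥ 4δ} · (1 + 1/(U − 3δ)) ] ≤ C · 𝔐_β(δ), where 𝔐_β(δ) = 1 + log(1/δ) if β = 1, 𝔐_β(δ) = 1 if β > 1, and 𝔐_β(δ) = δ^{−(1−β)} if β ∈ (0,1). -/

import Mathlib

open MeasureTheory

noncomputable section

/-- A prior `Γ` on `[0,1]` is `β`-regular with constants `(c0, C0, ε0)`. -/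
def BetaRegular (β : ℝ) (Γ : Measure ℝ) (c0 C0 ε0 : ℝ) : Prop :=
  0 < c0 ∧ c0 ≤ C0 ∧ 0 < ε0 ∧ ε0 < 1 ∧
  ∀ ε : ℝ, 0 < ε → ε ≤ ε0 →
    ENNReal.ofReal (c0 * ε ^ β) ≤ Γ (Set.Icc (1 - ε) 1) ∧
      Γ (Set.Icc (1 - ε) 1) ≤ ENNReal.ofReal (C0 * ε ^ β)

open scoped Classical in
/-- The tail-moment scaling `𝔐_β(δ)`. -/
def tailMomentScale (β δ : ℝ) : ℝ :=
  if β = 1 then 1 + Real.log (1 / δ) else if 1 < β then 1 else δ ^ (-(1 - β))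

theorem lintegral_Ioc_rpow {a : ℝ} (ha : 0 < a) (ha1 : a ≤ 1) (r : ℝ) :
    ∫⁻ t in Set.Ioc a 1, ENNReal.ofReal (t ^ r) = ENNReal.ofReal (∫ t in a..1, t ^ r) := by
  have h0 : (0 : ℝ) ∉ Set.uIcc a 1 := by
    rw [Set.uIcc_of_le ha1]
    exact fun h => absurd h.1 (not_le.2 ha)
  rw [intervalIntegral.integral_of_le ha1, ofReal_integral_eq_lintegral_ofReal]
  · exact (intervalIntegrable_iff_integrableOn_Ioc_of_le ha1).1
      (intervalIntegral.intervalIntegrable_rpow (Or.inr h0))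
  · filter_upwards [ae_restrict_mem measurableSet_Ioc] with t ht
    exact Real.rpow_nonneg (ha.trans ht.1).le r

/-- For `a ≤ u ≤ 1`, `1 / u` is an integral of indicators of `{u ≤ t}`, up to an additive `1`. -/
theorem ofReal_inv_le_one_add_lintegral {a u : ℝ} (ha : 0 < a) (hau : a ≤ u) (hu : u ≤ 1) :
    ENNReal.ofReal u⁻¹ ≤
      1 + ∫⁻ t in Set.Ioc a 1, (if u ≤ t then ENNReal.ofReal (t ^ (-2 : ℝ)) else 0) := by
  have hu0 : 0 < u := ha.trans_le hau
  have h0 : (0 : ℝ) ∉ Set.uIcc u 1 := by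
    rw [Set.uIcc_of_le hu]
    exact fun h => absurd h.1 (not_le.2 hu0)
  have hint : ∫ t in u..1, t ^ (-2 : ℝ) = u⁻¹ - 1 := by
    rw [integral_rpow (Or.inr ⟨by norm_num, h0⟩)]
    norm_num [Real.rpow_neg_one]
    ring
  have hle : ENNReal.ofReal (u⁻¹ - 1) ≤
      ∫⁻ t in Set.Ioc a 1, (if u ≤ t then ENNReal.ofReal (t ^ (-2 : ℝ)) else 0) := by
    rw [← hint, ← lintegral_Ioc_rpow hu0 hu]
    calc ∫⁻ t in Set.Ioc u 1, ENNReal.ofReal (t ^ (-2 : ℝ))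
        = ∫⁻ t in Set.Ioc u 1, (if u ≤ t then ENNReal.ofReal (t ^ (-2 : ℝ)) else 0) :=
          setLIntegral_congr_fun measurableSet_Ioc fun t ht => by simp [ht.1.le]
      _ ≤ _ := lintegral_mono_set (Set.Ioc_subset_Ioc_left hau)
  calc ENNReal.ofReal u⁻¹ = ENNReal.ofReal (1 + (u⁻¹ - 1)) := by congr 1; ring
    _ ≤ 1 + ENNReal.ofReal (u⁻¹ - 1) := by
        rw [← ENNReal.ofReal_one]
        exact ENNReal.ofReal_add_le
    _ ≤ _ := by gcongr

theorem one_add_integral_rpow_le_tailMomentScale {β δ : ℝ} (hδ : 0 < δ) (hδ1 : δ ≤ 1 / 8) :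
    1 + ∫ t in (4 * δ)..1, t ^ (β - 2) ≤ (1 + 1 / |β - 1|) * tailMomentScale β δ := by
  have ha : 0 < 4 * δ := by positivity
  have h0 : (0 : ℝ) ∉ Set.uIcc (4 * δ) 1 := by
    rw [Set.uIcc_of_le (by linarith)]
    exact fun h => absurd h.1 (not_le.2 ha)
  unfold tailMomentScale
  by_cases h1 : β = 1
  · subst h1
    have hr : ((1 : ℝ) - 2) = -1 := by norm_num
    simp only [hr, Real.rpow_neg_one, integral_inv_of_pos ha one_pos]
    have : Real.log (1 / (4 * δ)) ≤ Real.log (1 / δ) := by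
      apply Real.log_le_log (by positivity)
      gcongr
      linarith
    rw [if_pos trivial, sub_self, abs_zero, div_zero, add_zero, one_mul]
    linarith
  · have hr : β - 2 + 1 = β - 1 := by ring
    rw [integral_rpow (Or.inr ⟨fun h => h1 (by linarith), h0⟩), hr, Real.one_rpow, if_neg h1]
    split_ifs with h
    · have hb : 0 < β - 1 := by linarith
      rw [abs_of_pos hb, mul_one]
      gcongr
      linarith [Real.rpow_nonneg ha.le (β - 1)]
    · have hb : 0 < 1 - β := by
        have := lt_of_le_of_ne (not_lt.1 h) h1
        linarith
      have e1 : |β - 1| = 1 - β := by rw [abs_of_neg (by linarith)]; ring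
      have e2 : -(1 - β) = β - 1 := by ring
      have e3 : (1 - (4 * δ) ^ (β - 1)) / (β - 1) = ((4 * δ) ^ (β - 1) - 1) / (1 - β) := by
        rw [← neg_div_neg_eq]; ring
      have l1 : 1 ≤ δ ^ (β - 1) :=
        Real.one_le_rpow_of_pos_of_le_one_of_nonpos hδ (by linarith) (by linarith)
      have l2 : (4 * δ) ^ (β - 1) ≤ δ ^ (β - 1) :=
        Real.rpow_le_rpow_of_nonpos hδ (by linarith) (by linarith)
      rw [e1, e2, e3, add_mul, one_mul, one_div_mul_eq_div]
      gcongr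
      linarith

/-- The upper bound of `β`-regularity, extended from `(0, ε0]` to all of `(0, ∞)`. -/
theorem BetaRegular.measure_tail_le {β c0 C0 ε0 : ℝ} {Γ : Measure ℝ} [IsProbabilityMeasure Γ]
    (hβ : 0 ≤ β) (hΓ : Γ (Set.Icc (0 : ℝ) 1) = 1) (h : BetaRegular β Γ c0 C0 ε0)
    {t : ℝ} (ht : 0 < t) :
    Γ {x | 1 - x ≤ t} ≤ ENNReal.ofReal ((C0 + ε0⁻¹ ^ β) * t ^ β) := by
  obtain ⟨hc, hcC, hε, -, H⟩ := h
  have hae : ∀ᵐ x ∂Γ, x ∈ Set.Icc (0 : ℝ) 1 :=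
    (prob_compl_eq_zero_iff measurableSet_Icc).2 hΓ
  have htβ : 0 ≤ t ^ β := Real.rpow_nonneg ht.le β
  have hεβ : 0 ≤ ε0⁻¹ ^ β := by positivity
  rcases le_or_gt t ε0 with hle | hlt
  · calc Γ {x | 1 - x ≤ t} ≤ Γ (Set.Icc (1 - t) 1) := by
          apply measure_mono_ae
          filter_upwards [hae] with x hx hxt
          exact ⟨by have : 1 - x ≤ t := hxt
                    linarith, hx.2⟩
      _ ≤ ENNReal.ofReal (C0 * t ^ β) := (H t ht hle).2
      _ ≤ _ := by gcongr; linarith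
  · refine prob_le_one.trans ?_
    rw [ENNReal.one_le_ofReal]
    have h1 : 1 ≤ ε0⁻¹ ^ β * t ^ β := by
      rw [← Real.mul_rpow (by positivity) ht.le]
      apply Real.one_le_rpow _ hβ
      rw [inv_mul_eq_div, one_le_div hε]
      exact hlt.le
    nlinarith [mul_nonneg (hc.le.trans hcC) htβ]

/-- Tonelli bound for the truncated inverse moment. -/
theorem lintegral_lintegral_tail_le {β A a : ℝ} {Γ : Measure ℝ} [IsProbabilityMeasure Γ]
    (hA : 0 ≤ A) (ha : 0 < a) (ha1 : a ≤ 1)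
    (h : ∀ t, 0 < t → Γ {x | 1 - x ≤ t} ≤ ENNReal.ofReal (A * t ^ β)) :
    ∫⁻ x, (∫⁻ t in Set.Ioc a 1,
        (if 1 - x ≤ t then ENNReal.ofReal (t ^ (-2 : ℝ)) else 0)) ∂Γ ≤
      ENNReal.ofReal (A * ∫ t in a..1, t ^ (β - 2)) := by
  have hmeas : Measurable fun p : ℝ × ℝ =>
      if 1 - p.1 ≤ p.2 then ENNReal.ofReal (p.2 ^ (-2 : ℝ)) else 0 :=
    Measurable.ite (measurableSet_le (by fun_prop) (by fun_prop)) (by fun_prop) measurable_const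
  rw [lintegral_lintegral_swap hmeas.aemeasurable, ENNReal.ofReal_mul hA,
    ← lintegral_Ioc_rpow ha ha1, ← lintegral_const_mul _ (by fun_prop)]
  refine setLIntegral_mono (by fun_prop) fun t ht => ?_
  have ht0 : 0 < t := ha.trans ht.1
  have hS : MeasurableSet {x : ℝ | 1 - x ≤ t} := measurableSet_le (by fun_prop) (by fun_prop)
  calc ∫⁻ x, (if 1 - x ≤ t then ENNReal.ofReal (t ^ (-2 : ℝ)) else 0) ∂Γ
      = ∫⁻ x, {x : ℝ | 1 - x ≤ t}.indicator (fun _ => ENNReal.ofReal (t ^ (-2 : ℝ))) x ∂Γ := by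
        simp only [Set.indicator_apply, Set.mem_ofPred_eq]
    _ = ENNReal.ofReal (t ^ (-2 : ℝ)) * Γ {x | 1 - x ≤ t} := lintegral_indicator_const hS _
    _ ≤ ENNReal.ofReal (t ^ (-2 : ℝ)) * ENNReal.ofReal (A * t ^ β) := by
        gcongr
        exact h t ht0
    _ = ENNReal.ofReal A * ENNReal.ofReal (t ^ (β - 2)) := by
        rw [← ENNReal.ofReal_mul (Real.rpow_nonneg ht0.le _), ← ENNReal.ofReal_mul hA,
          sub_eq_add_neg, Real.rpow_add ht0]
        congr 1
        ring

/-- Tail-moment bound, general `β`.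
Let `Γ` be `β`-regular with constants `(c0, C0, ε0)`, `μ ∼ Γ`, `U = 1 − μ`, and fix
`δ ∈ (0, ε0/8]`. Then there is a constant `C < ∞`, depending only on `(β, c0, C0, ε0)`, with
`E[1{U ≥ 4δ}·(1 + 1/(U − 3δ))] ≤ C·𝔐_β(δ)`. -/
theorem tail_moment_bound
    (β c0 C0 ε0 : ℝ) (hβ : 0 < β)
    (hc0 : 0 < c0) (hc0C0 : c0 ≤ C0) (hε0 : 0 < ε0) (hε01 : ε0 < 1) :
    ∃ C > (0 : ℝ),
      ∀ Γ : Measure ℝ, IsProbabilityMeasure Γ → Γ (Set.Icc (0 : ℝ) 1) = 1 →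
        BetaRegular β Γ c0 C0 ε0 →
      ∀ δ : ℝ, 0 < δ → δ ≤ ε0 / 8 →
        (∫ x, Set.indicator {x : ℝ | 4 * δ ≤ 1 - x}
            (fun x => 1 + 1 / ((1 - x) - 3 * δ)) x ∂Γ) ≤ C * tailMomentScale β δ := by
  have hA : 0 ≤ C0 + ε0⁻¹ ^ β := add_nonneg (hc0.le.trans hc0C0) (by positivity)
  refine ⟨5 * ((1 + (C0 + ε0⁻¹ ^ β)) * (1 + 1 / |β - 1|)), by positivity, ?_⟩
  intro Γ _ hΓ hreg δ hδ hδε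
  set A := C0 + ε0⁻¹ ^ β
  have ha : 0 < 4 * δ := by positivity
  have ha1 : 4 * δ ≤ 1 := by linarith
  have hscale := one_add_integral_rpow_le_tailMomentScale (β := β) hδ (by linarith)
  set J := ∫ t in (4 * δ)..1, t ^ (β - 2)
  have hJ : 0 ≤ J := intervalIntegral.integral_nonneg ha1 fun t ht =>
    Real.rpow_nonneg (ha.le.trans ht.1) _
  have hbound : 5 * (1 + A * J) ≤
      5 * ((1 + A) * (1 + 1 / |β - 1|)) * tailMomentScale β δ := by
    nlinarith [mul_le_mul_of_nonneg_left hscale (add_nonneg zero_le_one hA)]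
  refine le_trans ?_ hbound
  have hS : MeasurableSet {x : ℝ | 4 * δ ≤ 1 - x} := measurableSet_le (by fun_prop) (by fun_prop)
  have hae : ∀ᵐ x ∂Γ, x ∈ Set.Icc (0 : ℝ) 1 :=
    (prob_compl_eq_zero_iff measurableSet_Icc).2 hΓ
  rw [integral_eq_lintegral_of_nonneg_ae]
  · apply ENNReal.toReal_le_of_le_ofReal (by positivity)
    calc ∫⁻ x, ENNReal.ofReal (Set.indicator {x : ℝ | 4 * δ ≤ 1 - x}
            (fun x => 1 + 1 / ((1 - x) - 3 * δ)) x) ∂Γ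
        ≤ ∫⁻ x, 5 * (1 + ∫⁻ t in Set.Ioc (4 * δ) 1,
            (if 1 - x ≤ t then ENNReal.ofReal (t ^ (-2 : ℝ)) else 0)) ∂Γ := by
          apply lintegral_mono_ae
          filter_upwards [hae] with x hx
          by_cases hxS : 4 * δ ≤ 1 - x
          · rw [Set.indicator_of_mem (show x ∈ {x : ℝ | 4 * δ ≤ 1 - x} from hxS)]
            have hu : 0 < 1 - x := by linarith
            have h1 : 1 ≤ (1 - x)⁻¹ := (one_le_inv₀ hu).2 (by linarith [hx.1])
            have h2 : 1 / ((1 - x) - 3 * δ) ≤ 4 * (1 - x)⁻¹ := by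
              rw [← div_eq_mul_inv, div_le_div_iff₀ (by linarith) hu]
              linarith
            calc ENNReal.ofReal (1 + 1 / ((1 - x) - 3 * δ))
                ≤ ENNReal.ofReal (5 * (1 - x)⁻¹) := ENNReal.ofReal_le_ofReal (by linarith)
              _ = 5 * ENNReal.ofReal (1 - x)⁻¹ := by
                  rw [ENNReal.ofReal_mul (by norm_num), ENNReal.ofReal_ofNat]
              _ ≤ _ := by
                  gcongr
                  exact ofReal_inv_le_one_add_lintegral ha hxS (by linarith [hx.1])
          · rw [Set.indicator_of_notMem (show x ∉ {x : ℝ | 4 * δ ≤ 1 - x} from hxS)]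
            simp
      _ = 5 * (1 + ∫⁻ x, (∫⁻ t in Set.Ioc (4 * δ) 1,
            (if 1 - x ≤ t then ENNReal.ofReal (t ^ (-2 : ℝ)) else 0)) ∂Γ) := by
          rw [lintegral_const_mul' _ _ (by norm_num), lintegral_add_left measurable_const]
          simp
      _ ≤ 5 * (1 + ENNReal.ofReal (A * J)) := by
          gcongr
          exact lintegral_lintegral_tail_le hA ha ha1 fun t ht =>
            hreg.measure_tail_le hβ.le hΓ ht
      _ = ENNReal.ofReal (5 * (1 + A * J)) := by
          rw [ENNReal.ofReal_mul (p := 5) (by norm_num),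
            ENNReal.ofReal_add zero_le_one (mul_nonneg hA hJ),
            ENNReal.ofReal_ofNat, ENNReal.ofReal_one]
  · refine Filter.Eventually.of_forall fun x => Set.indicator_nonneg (fun y hy => ?_) x
    have hy' : 4 * δ ≤ 1 - y := hy
    have : 0 < 1 - y - 3 * δ := by linarith
    positivity
  · exact (Measurable.indicator (by fun_prop) hS).aestronglyMeasurable
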